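/- Let q ≥ 2 be an integer and let β > 1 be a real number. There exists a constant Δ(q,β) > 0 such that |F″(x)| ≤ Δ(q,β) for all x ∈ (1/β, 1]. -/

import Mathlib

open scoped Classical
open Finset

/-- Spin configurations on `n` vertices with `q` spins. -/
abbrev Conf (n q : ℕ) := Fin n → Fin q

/-- Number of vertices assigned spin `j`. -/
def cntN {n q : ℕ} (X : Conf n q) (j : Fin q) : ℕ :=
  (Finset.univ.filter (fun v => X v = j)).card

/-- Number of monochromatic pairs `{u,v}` (`u < v`, same spin). -/
def numMono {n q : ℕ} (σ : Conf n q) : ℕ :=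
  (Finset.univ.filter (fun p : Fin n × Fin n => p.1 < p.2 ∧ σ p.1 = σ p.2)).card

/-- The mean-field `q`-state Potts measure: probability of `σ`. -/
noncomputable def pottsProb (n q : ℕ) (β : ℝ) (σ : Conf n q) : ℝ :=
  Real.exp (β / n * numMono σ) / ∑ τ : Conf n q, Real.exp (β / n * numMono τ)

/-- The set of monochromatic pairs of a configuration. -/
def monoPairs {n q : ℕ} (σ : Conf n q) : Finset (Fin n × Fin n) :=
  Finset.univ.filter (fun p : Fin n × Fin n => p.1 < p.2 ∧ σ p.1 = σ p.2)

/-- The graph on `Fin n` whose edges are the pairs in `E`. -/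
def graphOf {n : ℕ} (E : Finset (Fin n × Fin n)) : SimpleGraph (Fin n) :=
  SimpleGraph.fromRel (fun u v => (u, v) ∈ E)

/-- Number of connected components of the graph `(V, E)`. -/
noncomputable def numComps {n : ℕ} (E : Finset (Fin n × Fin n)) : ℕ :=
  Nat.card (graphOf E).ConnectedComponent

/-- One-step transition probability of the Swendsen–Wang dynamics:
percolate on monochromatic pairs with probability `p = 1 - exp (-β/n)`,
then color each connected component uniformly at random. -/
noncomputable def swStep (n q : ℕ) (β : ℝ) (σ τ : Conf n q) : ℝ :=
  ∑ E ∈ (monoPairs σ).powerset,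
    ((1 - Real.exp (-(β / n))) ^ E.card *
        Real.exp (-(β / n)) ^ ((monoPairs σ).card - E.card)) *
      (if ∀ u v : Fin n, (graphOf E).Reachable u v → τ u = τ v then
        ((q : ℝ))⁻¹ ^ numComps E else 0)

/-- `t`-step transition probability of the Swendsen–Wang dynamics. -/
noncomputable def swProb (n q : ℕ) (β : ℝ) : ℕ → Conf n q → Conf n q → ℝ
  | 0, σ, τ => if σ = τ then 1 else 0
  | t + 1, σ, τ => ∑ η : Conf n q, swStep n q β σ η * swProb n q β t η τ

/-- Probability of observing the trajectory `ω 0, ω 1, …, ω (ℓ-1)` at times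
`1, …, ℓ` for the SW dynamics started at `X₀`. -/
noncomputable def pathProb (n q : ℕ) (β : ℝ) (X₀ : Conf n q) (ℓ : ℕ)
    (ω : Fin ℓ → Conf n q) : ℝ :=
  ∏ i : Fin ℓ, swStep n q β
    (if _h : 0 < (i : ℕ) then
        ω ⟨(i : ℕ) - 1, lt_of_le_of_lt (Nat.sub_le _ _) i.isLt⟩
      else X₀) (ω i)

/-- Total variation distance between two probability vectors on configurations. -/
noncomputable def tvDist {n q : ℕ} (f g : Conf n q → ℝ) : ℝ :=
  (∑ τ : Conf n q, |f τ - g τ|) / 2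

/-- Mixing time `τ_mix(ε)` of the SW dynamics. -/
noncomputable def mixingTime (n q : ℕ) (β ε : ℝ) : ℕ :=
  sInf {t : ℕ | ∀ σ : Conf n q, tvDist (swProb n q β t σ) (pottsProb n q β) ≤ ε}

/-- `theta lam` is the unique root in `(0,1)` of `exp (-lam * x) = 1 - x`
for `lam > 1`, and `0` for `lam ≤ 1`. -/
noncomputable def theta (lam : ℝ) : ℝ :=
  if lam ≤ 1 then 0
  else sSup {x : ℝ | x ∈ Set.Ioo (0 : ℝ) 1 ∧ Real.exp (-lam * x) = 1 - x}

/-- The drift function `F`. -/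
noncomputable def F (q : ℕ) (β : ℝ) (x : ℝ) : ℝ :=
  1 / q + (1 - 1 / q) * theta (β * x) * x

/-- The unique fixed point of `F` in `(1/q, 1]` (for `β > q`). -/
noncomputable def aFix (q : ℕ) (β : ℝ) : ℝ :=
  sSup {x : ℝ | x ∈ Set.Ioc (1 / (q : ℝ)) 1 ∧ F q β x = x}

/-- The cutoff constant `c(β,q) = (2 log (1 / F'(a)))⁻¹`. -/
noncomputable def cConst (q : ℕ) (β : ℝ) : ℝ :=
  (2 * Real.log (1 / deriv (F q β) (aFix q β)))⁻¹

/-- Fraction of vertices assigned spin `j`. -/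
noncomputable def cntFrac {n q : ℕ} (X : Conf n q) : Fin q → ℝ :=
  fun j => (cntN X j : ℝ) / n

/-- The proportions vector `α(X)`: fractions of vertices of each spin,
sorted in nonincreasing order. -/
noncomputable def alphaVec {n q : ℕ} (X : Conf n q) : Fin q → ℝ :=
  fun i => cntFrac X (Tuple.sort (cntFrac X) i.rev)

/-- `ℓ∞` distance between two vectors indexed by `Fin q`. -/
noncomputable def linf {q : ℕ} (f g : Fin q → ℝ) : ℝ :=
  ⨆ i : Fin q, |f i - g i|

/-- The vector `κ(b) = (b, (1-b)/(q-1), …, (1-b)/(q-1))`. -/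
noncomputable def kappaVec (q : ℕ) (b : ℝ) : Fin q → ℝ :=
  fun i => if (i : ℕ) = 0 then b else (1 - b) / ((q : ℝ) - 1)

/-- The majority vector `m = (a, (1-a)/(q-1), …, (1-a)/(q-1))`. -/
noncomputable def mVec (q : ℕ) (β : ℝ) : Fin q → ℝ :=
  kappaVec q (aFix q β)

/-- Index of the most common spin of `X` (least such index on ties). -/
noncomputable def domIdx {n q : ℕ} (X : Conf n q) : ℕ :=
  sInf {j : ℕ | ∃ hj : j < q, ∀ j' : Fin q, cntN X j' ≤ cntN X ⟨j, hj⟩}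

/-- `α₁(X)`: fraction of vertices carrying the most common spin of `X`. -/
noncomputable def alpha1 {n q : ℕ} (X : Conf n q) : ℝ :=
  ((Finset.univ.filter (fun v : Fin n => (X v : ℕ) = domIdx X)).card : ℝ) / n

/-- `α_{1,k}(X)`: fraction of vertices of `Vk` carrying the most common spin of `X`. -/
noncomputable def alpha1In {n q : ℕ} (X : Conf n q) (Vk : Finset (Fin n)) : ℝ :=
  ((Vk.filter (fun v => (X v : ℕ) = domIdx X)).card : ℝ) / Vk.card

/-- `P` is a partition of the vertex set into `q` classes. -/
def IsPartition {n q : ℕ} (P : Fin q → Finset (Fin n)) : Prop :=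
  (∀ i j, i ≠ j → Disjoint (P i) (P j)) ∧ ∀ v : Fin n, ∃ i, v ∈ P i

/-- A `λ`-partition: a partition with all classes of size at least `λ n`. -/
def IsLamPartition {n q : ℕ} (lam : ℝ) (P : Fin q → Finset (Fin n)) : Prop :=
  IsPartition P ∧ ∀ i, lam * n ≤ ((P i).card : ℝ)

/-- Projection: `projCnt P X i j` is the number of vertices of `P i`
assigned spin `j` in `X`. -/
def projCnt {n q : ℕ} (P : Fin q → Finset (Fin n)) (X : Conf n q) :
    Fin q → Fin q → ℕ :=
  fun i j => ((P i).filter (fun v => X v = j)).card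

/-- All potential edges of the complete graph on `Fin n`. -/
def allPairs (n : ℕ) : Finset (Fin n × Fin n) :=
  Finset.univ.filter (fun p : Fin n × Fin n => p.1 < p.2)

/-- Probability of the edge set `E` under the Erdős–Rényi measure `G(n,p)`. -/
noncomputable def erProb (n : ℕ) (p : ℝ) (E : Finset (Fin n × Fin n)) : ℝ :=
  p ^ E.card * (1 - p) ^ ((allPairs n).card - E.card)

/-- Size of the connected component of `v` in the graph `(V, E)`. -/
noncomputable def compCard {n : ℕ} (E : Finset (Fin n × Fin n)) (v : Fin n) : ℕ :=
  (Finset.univ.filter (fun u => (graphOf E).Reachable v u)).card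

/-- `L₁`: size of the largest connected component. -/
noncomputable def L1 {n : ℕ} (E : Finset (Fin n × Fin n)) : ℕ :=
  Finset.univ.sup (fun v => compCard E v)

/-- Sum of the squares of the component sizes, `Σ_j L_j²`
(computed as `Σ_v |C(v)|`). -/
noncomputable def sumCompSq {n : ℕ} (E : Finset (Fin n × Fin n)) : ℕ :=
  ∑ v : Fin n, compCard E v

/-- Expectation of `f` under the Erdős–Rényi measure `G(n,p)`. -/
noncomputable def erExp (n : ℕ) (p : ℝ) (f : Finset (Fin n × Fin n) → ℝ) : ℝ :=
  ∑ E ∈ (allPairs n).powerset, erProb n p E * f E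

/-- Random-cluster weight of an edge set with parameters `q`, `p = 1 - exp (-β/n)`. -/
noncomputable def rcWeight (n q : ℕ) (β : ℝ) (E : Finset (Fin n × Fin n)) : ℝ :=
  (1 - Real.exp (-(β / n))) ^ E.card *
    Real.exp (-(β / n)) ^ ((allPairs n).card - E.card) * (q : ℝ) ^ numComps E

/-- The mean-field random-cluster measure: probability of the edge set `E`. -/
noncomputable def rcProb (n q : ℕ) (β : ℝ) (E : Finset (Fin n × Fin n)) : ℝ :=
  rcWeight n q β E / ∑ B ∈ (allPairs n).powerset, rcWeight n q β B

/-- The inverse of `theta` on `(0, 1)`: the parameter whose giant component has density `x`. -/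
noncomputable def thetaInv (x : ℝ) : ℝ := -Real.log (1 - x) / x

/-- The derivative of `thetaInv` on `(0, 1)`. -/
noncomputable def thetaInvDeriv (x : ℝ) : ℝ := (x / (1 - x) + Real.log (1 - x)) / x ^ 2

/-- The second derivative of `thetaInv` on `(0, 1)`. -/
noncomputable def thetaInvDeriv₂ (x : ℝ) : ℝ :=
  (x ^ 2 / (1 - x) ^ 2 - 2 * (x / (1 - x)) - 2 * Real.log (1 - x)) / x ^ 3

lemma hasDerivAt_log_one_sub {x : ℝ} (hx : x < 1) :
    HasDerivAt (fun y : ℝ => Real.log (1 - y)) (-1 / (1 - x)) x :=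
  ((hasDerivAt_id x).const_sub 1).log (by simp; linarith)

lemma hasDerivAt_div_one_sub {x : ℝ} (hx : x < 1) :
    HasDerivAt (fun y : ℝ => y / (1 - y)) (1 / (1 - x) ^ 2) x := by
  have h1 : (1 - x) ≠ 0 := by linarith
  refine ((hasDerivAt_id x).div ((hasDerivAt_id x).const_sub 1) h1).congr_deriv ?_
  simp

lemma hasStrictDerivAt_thetaInv {x : ℝ} (hx : x ∈ Set.Ioo (0 : ℝ) 1) :
    HasStrictDerivAt thetaInv (thetaInvDeriv x) x := by
  have h0 : x ≠ 0 := hx.1.ne'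
  have h1 : 1 - x ≠ 0 := by linarith [hx.2]
  have h := ((((hasStrictDerivAt_id x).const_sub 1).log h1).neg).div (hasStrictDerivAt_id x) h0
  refine h.congr_deriv ?_
  simp only [thetaInvDeriv, id, Pi.neg_apply]
  field_simp
  ring

lemma hasDerivAt_thetaInvDeriv {x : ℝ} (hx : x ∈ Set.Ioo (0 : ℝ) 1) :
    HasDerivAt thetaInvDeriv (thetaInvDeriv₂ x) x := by
  have h0 : x ≠ 0 := hx.1.ne'
  have h1 : 1 - x ≠ 0 := by linarith [hx.2]
  have h := ((hasDerivAt_div_one_sub hx.2).add (hasDerivAt_log_one_sub hx.2)).div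
    (hasDerivAt_pow 2 x) (pow_ne_zero 2 h0)
  refine h.congr_deriv ?_
  simp only [thetaInvDeriv₂, Pi.add_apply]
  field_simp
  ring

/-- A function vanishing at `0` with nonnegative derivative on `[0, 1)` is nonnegative there. -/
lemma nonneg_of_hasDerivAt_nonneg {f f' : ℝ → ℝ} (hf0 : f 0 = 0)
    (hf : ∀ x ∈ Set.Ico (0 : ℝ) 1, HasDerivAt f (f' x) x)
    (hf' : ∀ x ∈ Set.Ico (0 : ℝ) 1, 0 ≤ f' x) {x : ℝ} (hx : x ∈ Set.Ico (0 : ℝ) 1) :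
    0 ≤ f x := by
  have hmono : MonotoneOn f (Set.Ico 0 1) := by
    refine monotoneOn_of_hasDerivWithinAt_nonneg (f' := f') (convex_Ico 0 1)
      (fun y hy => (hf y hy).continuousAt.continuousWithinAt)
      (fun y hy => (hf y (interior_subset hy)).hasDerivWithinAt)
      (fun y hy => hf' y (interior_subset hy))
  simpa [hf0] using hmono ⟨le_refl 0, one_pos⟩ hx hx.1

lemma half_le_thetaInvDeriv {x : ℝ} (hx : x ∈ Set.Ioo (0 : ℝ) 1) :
    1 / 2 ≤ thetaInvDeriv x := by
  have h := nonneg_of_hasDerivAt_nonneg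
    (f := fun y => y / (1 - y) + Real.log (1 - y) - 1 / 2 * y ^ 2)
    (f' := fun y => 1 / (1 - y) ^ 2 + -1 / (1 - y) - y) (by simp)
    (fun y hy => by
      refine (((hasDerivAt_div_one_sub hy.2).add (hasDerivAt_log_one_sub hy.2)).sub
        ((hasDerivAt_pow 2 y).const_mul (1 / 2))).congr_deriv ?_
      simp)
    (fun y hy => by
      have h1 : 0 < 1 - y := by linarith [hy.2]
      have h2 : (1 - y) ^ 2 ≤ 1 := by nlinarith [hy.1]
      have h3 : 1 / (1 - y) ^ 2 + -1 / (1 - y) = y / (1 - y) ^ 2 := by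
        field_simp
        ring
      rw [h3, sub_nonneg, le_div_iff₀ (by positivity)]
      nlinarith [hy.1])
    ⟨hx.1.le, hx.2⟩
  rw [thetaInvDeriv, le_div_iff₀ (pow_pos hx.1 2)]
  linarith

lemma hasDerivAt_thetaInvDeriv₂_num {x : ℝ} (hx : x < 1) :
    HasDerivAt (fun y : ℝ => y ^ 2 / (1 - y) ^ 2 - 2 * (y / (1 - y)) - 2 * Real.log (1 - y))
      (2 * x ^ 2 / (1 - x) ^ 3) x := by
  have h1 : 1 - x ≠ 0 := by linarith
  have h := (((hasDerivAt_div_one_sub hx).pow 2).sub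
    ((hasDerivAt_div_one_sub hx).const_mul 2)).sub ((hasDerivAt_log_one_sub hx).const_mul 2)
  simp only [← div_pow]
  refine h.congr_deriv ?_
  simp only [Nat.add_one_sub_one, pow_one]
  field_simp
  push_cast
  ring

lemma abs_thetaInvDeriv₂_le {x : ℝ} (hx : x ∈ Set.Ioo (0 : ℝ) 1) :
    |thetaInvDeriv₂ x| ≤ 1 / (1 - x) ^ 3 := by
  have hx' : x ∈ Set.Ico (0 : ℝ) 1 := ⟨hx.1.le, hx.2⟩
  have hlow := nonneg_of_hasDerivAt_nonneg (by simp)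
    (fun y hy => hasDerivAt_thetaInvDeriv₂_num hy.2)
    (fun y hy => by
      have h1 : 0 < 1 - y := by linarith [hy.2]
      positivity) hx'
  have hup := nonneg_of_hasDerivAt_nonneg (by simp)
    (fun y hy => ((hasDerivAt_div_one_sub hy.2).pow 3).sub
      (hasDerivAt_thetaInvDeriv₂_num hy.2))
    (fun y hy => by
      have h1 : 0 < 1 - y := by linarith [hy.2]
      have h2 : ((3 : ℕ) : ℝ) * (y / (1 - y)) ^ (3 - 1) * (1 / (1 - y) ^ 2)
          - 2 * y ^ 2 / (1 - y) ^ 3 = y ^ 2 * (1 + 2 * y) / (1 - y) ^ 4 := by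
        simp only [Nat.add_one_sub_one]
        field_simp
        push_cast
        ring
      rw [h2]
      have := hy.1
      positivity) hx'
  have hpos := pow_pos hx.1 3
  have h1 : 0 < 1 - x := by linarith [hx.2]
  rw [thetaInvDeriv₂, abs_of_nonneg (div_nonneg hlow hpos.le), div_le_iff₀ hpos]
  simp only [Pi.sub_apply, Pi.pow_apply, div_pow] at hup
  rw [one_div_mul_eq_div]
  linarith

lemma strictMonoOn_thetaInv : StrictMonoOn thetaInv (Set.Ioo 0 1) :=
  strictMonoOn_of_hasDerivWithinAt_pos (convex_Ioo 0 1)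
    (fun _ hx => (hasStrictDerivAt_thetaInv hx).hasDerivAt.continuousAt.continuousWithinAt)
    (fun _ hx => (hasStrictDerivAt_thetaInv (interior_subset hx)).hasDerivAt.hasDerivWithinAt)
    (fun _ hx => by linarith [half_le_thetaInvDeriv (interior_subset hx)])

lemma one_lt_thetaInv {x : ℝ} (hx : x ∈ Set.Ioo (0 : ℝ) 1) : 1 < thetaInv x := by
  rw [thetaInv, lt_div_iff₀ hx.1]
  have := Real.log_lt_sub_one_of_pos (x := 1 - x) (by linarith [hx.2]) (by linarith [hx.1])
  linarith

lemma exp_eq_iff_thetaInv_eq {lam x : ℝ} (hx : x ∈ Set.Ioo (0 : ℝ) 1) :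
    Real.exp (-lam * x) = 1 - x ↔ thetaInv x = lam := by
  have h1 : 0 < 1 - x := by linarith [hx.2]
  rw [thetaInv, div_eq_iff hx.1.ne', ← Real.exp_log h1, Real.exp_eq_exp, Real.exp_log h1]
  constructor <;> intro h <;> linarith

lemma theta_thetaInv {x : ℝ} (hx : x ∈ Set.Ioo (0 : ℝ) 1) : theta (thetaInv x) = x := by
  have hset : {y : ℝ | y ∈ Set.Ioo (0 : ℝ) 1 ∧ Real.exp (-thetaInv x * y) = 1 - y} = {x} := by
    ext y
    simp only [Set.mem_ofPred_eq, Set.mem_singleton_iff]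
    constructor
    · rintro ⟨hy, h⟩
      exact strictMonoOn_thetaInv.injOn hy hx ((exp_eq_iff_thetaInv_eq hy).1 h)
    · rintro rfl
      exact ⟨hx, (exp_eq_iff_thetaInv_eq hx).2 rfl⟩
  rw [theta, if_neg (not_le.2 (one_lt_thetaInv hx)), hset, csSup_singleton]

lemma exists_thetaInv_eq {lam : ℝ} (hlam : 1 < lam) :
    ∃ x ∈ Set.Ioo (0 : ℝ) 1, thetaInv x = lam := by
  have hpos : 0 < lam := by linarith
  have ha : 1 - lam⁻¹ ∈ Set.Ioo (0 : ℝ) 1 :=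
    ⟨by linarith [inv_lt_one_of_one_lt₀ hlam], by linarith [inv_pos.2 hpos]⟩
  have hb : 1 - Real.exp (-lam) ∈ Set.Ioo (0 : ℝ) 1 :=
    ⟨by linarith [Real.exp_lt_one_iff.2 (neg_lt_zero.2 hpos)], by linarith [Real.exp_pos (-lam)]⟩
  have hfa : thetaInv (1 - lam⁻¹) ≤ lam := by
    rw [thetaInv, div_le_iff₀ ha.1]
    have := Real.log_le_sub_one_of_pos hpos
    simp only [sub_sub_cancel, Real.log_inv, neg_neg]
    rw [mul_sub, mul_inv_cancel₀ hpos.ne']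
    linarith
  have hfb : lam ≤ thetaInv (1 - Real.exp (-lam)) := by
    rw [thetaInv, le_div_iff₀ hb.1]
    simp only [sub_sub_cancel, Real.log_exp, neg_neg]
    nlinarith [hb.2]
  obtain ⟨x, hx, hxl⟩ := isPreconnected_Ioo.intermediate_value ha hb
    (fun y hy => (hasStrictDerivAt_thetaInv hy).hasDerivAt.continuousAt.continuousWithinAt)
    ⟨hfa, hfb⟩
  exact ⟨x, hx, hxl⟩

lemma theta_mem_Ioo {lam : ℝ} (hlam : 1 < lam) : theta lam ∈ Set.Ioo (0 : ℝ) 1 := by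
  obtain ⟨x, hx, rfl⟩ := exists_thetaInv_eq hlam
  rwa [theta_thetaInv hx]

lemma exp_neg_le_one_sub_theta {lam : ℝ} (hlam : 1 < lam) :
    Real.exp (-lam) ≤ 1 - theta lam := by
  obtain ⟨x, hx, rfl⟩ := exists_thetaInv_eq hlam
  rw [theta_thetaInv hx, ← (exp_eq_iff_thetaInv_eq hx).2 rfl, Real.exp_le_exp]
  nlinarith [hx.2]

lemma hasDerivAt_theta {lam : ℝ} (hlam : 1 < lam) :
    HasDerivAt theta (thetaInvDeriv (theta lam))⁻¹ lam := by
  obtain ⟨x, hx, rfl⟩ := exists_thetaInv_eq hlam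
  rw [theta_thetaInv hx]
  refine ((hasStrictDerivAt_thetaInv hx).to_local_left_inverse
    (by linarith [half_le_thetaInvDeriv hx] : (0 : ℝ) < thetaInvDeriv x).ne' ?_).hasDerivAt
  filter_upwards [isOpen_Ioo.mem_nhds hx] with y hy using theta_thetaInv hy

lemma hasDerivAt_inv_thetaInvDeriv_theta {lam : ℝ} (hlam : 1 < lam) :
    HasDerivAt (fun y => (thetaInvDeriv (theta y))⁻¹)
      (-(thetaInvDeriv₂ (theta lam) * (thetaInvDeriv (theta lam))⁻¹) /
        thetaInvDeriv (theta lam) ^ 2) lam := by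
  have hx := theta_mem_Ioo hlam
  exact ((hasDerivAt_thetaInvDeriv hx).comp lam (hasDerivAt_theta hlam)).inv
    (by linarith [half_le_thetaInvDeriv hx] : (0 : ℝ) < thetaInvDeriv (theta lam)).ne'

lemma abs_theta_second_deriv_le {lam b : ℝ} (hlam : 1 < lam) (hb : lam ≤ b) :
    |-(thetaInvDeriv₂ (theta lam) * (thetaInvDeriv (theta lam))⁻¹) /
      thetaInvDeriv (theta lam) ^ 2| ≤ 8 / Real.exp (-b) ^ 3 := by
  have hx := theta_mem_Ioo hlam
  have h1 := half_le_thetaInvDeriv hx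
  have h2 := abs_thetaInvDeriv₂_le hx
  have h3 : Real.exp (-b) ≤ 1 - theta lam :=
    (Real.exp_le_exp.2 (neg_le_neg hb)).trans (exp_neg_le_one_sub_theta hlam)
  set d := thetaInvDeriv (theta lam)
  have hd : 0 < d := by linarith
  have he := Real.exp_pos (-b)
  have h4 : |thetaInvDeriv₂ (theta lam)| ≤ 1 / Real.exp (-b) ^ 3 := h2.trans (by gcongr)
  have h5 : -(thetaInvDeriv₂ (theta lam) * d⁻¹) / d ^ 2 = -(thetaInvDeriv₂ (theta lam) / d ^ 3) := by
    field_simp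
  rw [h5, abs_neg, abs_div, abs_of_pos (pow_pos hd 3)]
  calc |thetaInvDeriv₂ (theta lam)| / d ^ 3
      ≤ (1 / Real.exp (-b) ^ 3) / (1 / 2) ^ 3 := by gcongr
    _ = 8 / Real.exp (-b) ^ 3 := by ring

lemma hasDerivAt_F (q : ℕ) {β x : ℝ} (hx : 1 < β * x) :
    HasDerivAt (F q β)
      ((1 - 1 / q) * (theta (β * x) + β * x * (thetaInvDeriv (theta (β * x)))⁻¹)) x := by
  have hlin : HasDerivAt (fun y => β * y) β x := by
    simpa using (hasDerivAt_id x).const_mul β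
  have h := ((((hasDerivAt_theta hx).comp x hlin).const_mul (1 - 1 / (q : ℝ))).mul
    (hasDerivAt_id x)).const_add (1 / (q : ℝ))
  have hF : F q β = fun y => 1 / (q : ℝ) + (1 - 1 / (q : ℝ)) * theta (β * y) * y := rfl
  rw [hF]
  refine h.congr_deriv ?_
  simp only [Function.comp_apply, id]
  ring

lemma hasDerivAt_deriv_F (q : ℕ) {β x : ℝ} (hx : 1 < β * x) :
    HasDerivAt (deriv (F q β))
      ((1 - 1 / q) * (2 * β * (thetaInvDeriv (theta (β * x)))⁻¹ + β ^ 2 * x *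
        (-(thetaInvDeriv₂ (theta (β * x)) * (thetaInvDeriv (theta (β * x)))⁻¹) /
          thetaInvDeriv (theta (β * x)) ^ 2))) x := by
  have hlin : HasDerivAt (fun y => β * y) β x := by
    simpa using (hasDerivAt_id x).const_mul β
  have h := (((hasDerivAt_theta hx).comp x hlin).add
    (hlin.mul ((hasDerivAt_inv_thetaInvDeriv_theta hx).comp x hlin))).const_mul (1 - 1 / (q : ℝ))
  refine HasDerivAt.congr_of_eventuallyEq (?_ : HasDerivAt (fun y => (1 - 1 / (q : ℝ)) *
    (theta (β * y) + β * y * (thetaInvDeriv (theta (β * y)))⁻¹)) _ x) ?_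
  · refine h.congr_deriv ?_
    simp only [Function.comp_apply]
    ring
  · filter_upwards [hlin.continuousAt.eventually (lt_mem_nhds hx)] with y hy
    exact (hasDerivAt_F q hy).deriv

/-- Fact 2.3: for `β > 1` there is a constant `Δ(q,β) > 0` with
`|F''(x)| ≤ Δ(q,β)` for all `x ∈ (1/β, 1]`. -/
theorem drift_second_deriv_bounded (q : ℕ) (hq : 2 ≤ q) (β : ℝ) (hβ : 1 < β) :
    ∃ Δ : ℝ, 0 < Δ ∧ ∀ x ∈ Set.Ioc (1 / β) 1,
      |deriv (deriv (F q β)) x| ≤ Δ := by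
  have hβ0 : 0 < β := by linarith
  refine ⟨4 * β + β ^ 2 * (8 / Real.exp (-β) ^ 3), by positivity, fun x hx => ?_⟩
  have hlam : 1 < β * x := by
    have := (div_lt_iff₀ hβ0).1 hx.1
    linarith
  have hx0 : 0 < x := lt_trans (by positivity) hx.1
  rw [(hasDerivAt_deriv_F q hlam).deriv]
  have h2 := abs_theta_second_deriv_le hlam (b := β) (by nlinarith [hx.2])
  have h1 := half_le_thetaInvDeriv (theta_mem_Ioo hlam)
  set s := -(thetaInvDeriv₂ (theta (β * x)) * (thetaInvDeriv (theta (β * x)))⁻¹) /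
    thetaInvDeriv (theta (β * x)) ^ 2
  set d := thetaInvDeriv (theta (β * x))
  have hd : 0 < d := by linarith
  have hdinv : d⁻¹ ≤ 2 := by
    rw [inv_le_comm₀ hd two_pos]
    linarith
  have hq1 : (1 : ℝ) / q ≤ 1 := by
    rw [div_le_one (by positivity)]
    exact_mod_cast (by omega : 1 ≤ q)
  have hc : |1 - 1 / (q : ℝ)| ≤ 1 := by
    rw [abs_of_nonneg (by linarith)]
    have : (0 : ℝ) ≤ 1 / q := by positivity
    linarith
  calc |(1 - 1 / (q : ℝ)) * (2 * β * d⁻¹ + β ^ 2 * x * s)|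
      ≤ 1 * |2 * β * d⁻¹ + β ^ 2 * x * s| := by
        rw [abs_mul]
        gcongr
    _ ≤ |2 * β * d⁻¹| + |β ^ 2 * x * s| := by
        rw [one_mul]
        exact abs_add_le _ _
    _ = 2 * β * d⁻¹ + β ^ 2 * x * |s| := by
        rw [abs_of_pos (by positivity), abs_mul, abs_of_pos (by positivity)]
    _ ≤ 2 * β * 2 + β ^ 2 * 1 * (8 / Real.exp (-β) ^ 3) := by
        gcongr
        exact hx.2
    _ = 4 * β + β ^ 2 * (8 / Real.exp (-β) ^ 3) := by ring
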